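/- (Deterministic form of Theorem 1.) Under Assumption 1 and the Algorithm hypotheses, let (π*, μ*) be a B-MFE and set e^k_π := ‖π^k − Γ₁^λ(μ^k)‖_TV and e^k_μ := ‖μ^k − μ*‖₁. Then there exists a constant C > 0 depending only on |𝒮|, |𝒜|, d₁, d₂, d₃, c_π, c_μ, θ, and γ (and not on K, ε, δ, ε_P, ε_Q, λ, P, R, ρ) such that (1/K) Σ_{k=1}^{K−1} e^k_π ≤ C (K^{θ−1} + ε_Q + K^{θ−γ} + δ + ε) and (1/K) Σ_{k=1}^{K−1} e^k_μ ≤ C (K^{γ−1} + ε + ε_P + ε_Q + K^{θ−1} + K^{θ−γ} + δ). -/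

import Mathlib

open Finset Real

noncomputable section MFG

/-- `μ` is a probability vector on the finite set `S`. -/
def isSimplex {S : Type*} [Fintype S] (μ : S → ℝ) : Prop :=
  (∀ s, 0 ≤ μ s) ∧ ∑ s, μ s = 1

/-- `π : S → Δ(A)` is a policy. -/
def isPolicy {S A : Type*} [Fintype A] (po : S → A → ℝ) : Prop :=
  ∀ s, isSimplex (po s)

/-- The `ℓ¹` norm `‖f‖₁ = Σ_s |f s|`. -/
def l1Norm {S : Type*} [Fintype S] (f : S → ℝ) : ℝ := ∑ s, |f s|

/-- The TV-type norm `‖f‖_TV = max_s Σ_a |f s a|`. -/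
def tvNorm {S A : Type*} [Fintype S] [Fintype A] [Nonempty S] (f : S → A → ℝ) : ℝ :=
  Finset.univ.sup' Finset.univ_nonempty (fun s => ∑ a, |f s a|)

/-- The Frobenius norm of an `S × S` matrix. -/
def frobNorm {S : Type*} [Fintype S] (M : S → S → ℝ) : ℝ :=
  Real.sqrt (∑ s, ∑ s', (M s s') ^ 2)

/-- The softmax policy `softmax_λ(s,Q)_a = exp(λ Q(s,a))/Σ_{a'} exp(λ Q(s,a'))`. -/
def softmaxPol {S A : Type*} [Fintype A] (lam : ℝ) (Q : S → A → ℝ) (s : S) (a : A) : ℝ :=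
  Real.exp (lam * Q s a) / ∑ a', Real.exp (lam * Q s a')

/-- The consistency operator `Γ₂(π,μ)(s') = Σ_{s,a} P(s'|s,a,μ) π(a|s) μ(s)`. -/
def gamma2 {S A : Type*} [Fintype S] [Fintype A]
    (P : S → A → (S → ℝ) → S → ℝ) (po : S → A → ℝ) (μ : S → ℝ) (s' : S) : ℝ :=
  ∑ s, ∑ a, P s a μ s' * po s a * μ s

/-- The state-transition matrix `P_{π,μ}(s,s') = Σ_a P(s'|s,a,μ) π(a|s)`. -/
def transMat {S A : Type*} [Fintype A]
    (P : S → A → (S → ℝ) → S → ℝ) (po : S → A → ℝ) (μ : S → ℝ) (s s' : S) : ℝ :=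
  ∑ a, P s a μ s' * po s a

end MFG

lemma sum_abs_le_tvNorm {S A : Type*} [Fintype S] [Fintype A] [Nonempty S] (f : S → A → ℝ) (s : S) :
    ∑ a, |f s a| ≤ tvNorm f :=
  Finset.le_sup' (fun s => ∑ a, |f s a|) (Finset.mem_univ s)

lemma tvNorm_le {S A : Type*} [Fintype S] [Fintype A] [Nonempty S] {f : S → A → ℝ} {c : ℝ}
    (h : ∀ s, ∑ a, |f s a| ≤ c) : tvNorm f ≤ c :=
  Finset.sup'_le _ _ fun s _ => h s

lemma tvNorm_nonneg {S A : Type*} [Fintype S] [Fintype A] [Nonempty S] (f : S → A → ℝ) :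
    0 ≤ tvNorm f :=
  (Finset.sum_nonneg fun _ _ => abs_nonneg _).trans (sum_abs_le_tvNorm f (Classical.arbitrary S))

lemma l1Norm_nonneg {S : Type*} [Fintype S] (f : S → ℝ) : 0 ≤ l1Norm f :=
  Finset.sum_nonneg fun _ _ => abs_nonneg _

lemma l1Norm_sub_le_add {S : Type*} [Fintype S] (f g h : S → ℝ) :
    l1Norm (fun s => f s - h s) ≤ l1Norm (fun s => f s - g s) + l1Norm (fun s => g s - h s) := by
  unfold l1Norm
  rw [← Finset.sum_add_distrib]
  exact Finset.sum_le_sum fun s _ => abs_sub_le _ _ _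

lemma isSimplex.sum_abs {S : Type*} [Fintype S] {μ : S → ℝ} (h : isSimplex μ) :
    ∑ s, |μ s| = 1 := by
  rw [← h.2]
  exact Finset.sum_congr rfl fun s _ => abs_of_nonneg (h.1 s)

lemma isSimplex.sum_abs_sub_le_two {S : Type*} [Fintype S] {μ ν : S → ℝ}
    (hμ : isSimplex μ) (hν : isSimplex ν) : ∑ s, |μ s - ν s| ≤ 2 := by
  calc ∑ s, |μ s - ν s| ≤ ∑ s, (|μ s| + |ν s|) := Finset.sum_le_sum fun s _ => abs_sub _ _
    _ = 2 := by rw [Finset.sum_add_distrib, hμ.sum_abs, hν.sum_abs]; norm_num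

lemma isSimplex_uniform {A : Type*} [Fintype A] [Nonempty A] :
    isSimplex (fun _ : A => 1 / (Fintype.card A : ℝ)) := by
  refine ⟨fun _ => by positivity, ?_⟩
  simp

lemma isPolicy_softmaxPol {S A : Type*} [Fintype A] [Nonempty A] (lam : ℝ) (Q : S → A → ℝ) :
    isPolicy (softmaxPol lam Q) := by
  intro s
  have hpos : 0 < ∑ a', Real.exp (lam * Q s a') :=
    Finset.sum_pos (fun _ _ => Real.exp_pos _) Finset.univ_nonempty
  refine ⟨fun a => by unfold softmaxPol; positivity, ?_⟩
  simp only [softmaxPol]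
  rw [← Finset.sum_div, div_self hpos.ne']

lemma softmaxPol_sub_le {S A : Type*} [Fintype A] [Nonempty A] {lam η : ℝ} {Q Q' : S → A → ℝ}
    {s : S} (h : ∀ a, |lam * Q s a - lam * Q' s a| ≤ η) (a : A) :
    softmaxPol lam Q s a - softmaxPol lam Q' s a ≤ 2 * η * softmaxPol lam Q s a := by
  have hX : 0 < ∑ a', Real.exp (lam * Q s a') :=
    Finset.sum_pos (fun _ _ => Real.exp_pos _) Finset.univ_nonempty
  have hY : 0 < ∑ a', Real.exp (lam * Q' s a') :=
    Finset.sum_pos (fun _ _ => Real.exp_pos _) Finset.univ_nonempty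
  have hYX : ∑ a', Real.exp (lam * Q' s a') ≤ Real.exp η * ∑ a', Real.exp (lam * Q s a') := by
    rw [Finset.mul_sum]
    refine Finset.sum_le_sum fun b _ => ?_
    rw [← Real.exp_add, Real.exp_le_exp]
    linarith [(abs_le.1 (h b)).1]
  have hratio : Real.exp (-(2 * η)) * softmaxPol lam Q s a ≤ softmaxPol lam Q' s a := by
    unfold softmaxPol
    rw [← mul_div_assoc, div_le_div_iff₀ hX hY]
    calc Real.exp (-(2 * η)) * Real.exp (lam * Q s a) * ∑ a', Real.exp (lam * Q' s a')
        ≤ Real.exp (-(2 * η)) * Real.exp (lam * Q s a)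
            * (Real.exp η * ∑ a', Real.exp (lam * Q s a')) := by gcongr
      _ = Real.exp (lam * Q s a - η) * ∑ a', Real.exp (lam * Q s a') := by
          rw [← mul_assoc, ← Real.exp_add, ← Real.exp_add]
          ring_nf
      _ ≤ Real.exp (lam * Q' s a) * ∑ a', Real.exp (lam * Q s a') := by
          gcongr
          linarith [(abs_le.1 (h a)).2]
  have hexp : 1 - 2 * η ≤ Real.exp (-(2 * η)) := by linarith [Real.add_one_le_exp (-(2 * η))]
  have := mul_le_mul_of_nonneg_right hexp ((isPolicy_softmaxPol lam Q s).1 a)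
  linarith

lemma sum_abs_softmaxPol_sub_le {S A : Type*} [Fintype A] [Nonempty A] {lam η : ℝ}
    {Q Q' : S → A → ℝ} {s : S} (h : ∀ a, |lam * Q s a - lam * Q' s a| ≤ η) :
    ∑ a, |softmaxPol lam Q s a - softmaxPol lam Q' s a| ≤ 4 * η := by
  have hη : 0 ≤ η := (abs_nonneg _).trans (h (Classical.arbitrary A))
  calc ∑ a, |softmaxPol lam Q s a - softmaxPol lam Q' s a|
      ≤ ∑ a, 2 * η * (softmaxPol lam Q s a + softmaxPol lam Q' s a) := by
        refine Finset.sum_le_sum fun a _ => ?_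
        have h1 := softmaxPol_sub_le h a
        have h2 := softmaxPol_sub_le (Q := Q') (Q' := Q) (fun b => by rw [abs_sub_comm]; exact h b) a
        have p1 := mul_nonneg (mul_nonneg zero_le_two hη) ((isPolicy_softmaxPol lam Q s).1 a)
        have p2 := mul_nonneg (mul_nonneg zero_le_two hη) ((isPolicy_softmaxPol lam Q' s).1 a)
        rw [abs_le]
        constructor <;> linarith
    _ = 4 * η := by
        rw [← Finset.mul_sum, Finset.sum_add_distrib, (isPolicy_softmaxPol lam Q s).2,
          (isPolicy_softmaxPol lam Q' s).2]
        ring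

lemma abs_le_frobNorm {S : Type*} [Fintype S] (M : S → S → ℝ) (s s' : S) :
    |M s s'| ≤ frobNorm M := by
  refine Real.abs_le_sqrt ?_
  calc M s s' ^ 2 ≤ ∑ t', M s t' ^ 2 :=
        Finset.single_le_sum (f := fun t' => M s t' ^ 2) (fun _ _ => sq_nonneg _)
          (Finset.mem_univ s')
    _ ≤ ∑ t, ∑ t', M t t' ^ 2 :=
        Finset.single_le_sum (f := fun t => ∑ t', M t t' ^ 2)
          (fun _ _ => Finset.sum_nonneg fun _ _ => sq_nonneg _) (Finset.mem_univ s)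

lemma gamma2_eq_sum_transMat {S A : Type*} [Fintype S] [Fintype A]
    (P : S → A → (S → ℝ) → S → ℝ) (po : S → A → ℝ) (μ : S → ℝ) (s' : S) :
    gamma2 P po μ s' = ∑ s, transMat P po μ s s' * μ s := by
  simp only [gamma2, transMat, Finset.sum_mul]

lemma sum_abs_sum_mul_le {S : Type*} [Fintype S] {M : S → S → ℝ} {c : ℝ} {v : S → ℝ}
    (hM : ∀ s', ∑ s, |M s' s| ≤ c) :
    ∑ s, |∑ s', M s' s * v s'| ≤ c * l1Norm v := by
  calc ∑ s, |∑ s', M s' s * v s'| ≤ ∑ s, ∑ s', |M s' s| * |v s'| := by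
        refine Finset.sum_le_sum fun s _ => (Finset.abs_sum_le_sum_abs _ _).trans_eq ?_
        simp only [abs_mul]
    _ = ∑ s', (∑ s, |M s' s|) * |v s'| := by
        rw [Finset.sum_comm]
        simp only [Finset.sum_mul]
    _ ≤ ∑ s', c * |v s'| :=
        Finset.sum_le_sum fun s' _ => mul_le_mul_of_nonneg_right (hM s') (abs_nonneg _)
    _ = c * l1Norm v := by rw [← Finset.mul_sum, l1Norm]

lemma isSimplex.sum_mul {S : Type*} [Fintype S] {M : S → S → ℝ} {μ : S → ℝ}
    (hμ : isSimplex μ) (hM : ∀ s, isSimplex (M s)) :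
    isSimplex (fun s => ∑ s', M s' s * μ s') := by
  refine ⟨fun s => Finset.sum_nonneg fun s' _ => mul_nonneg ((hM s').1 s) (hμ.1 s'), ?_⟩
  rw [Finset.sum_comm]
  simp only [← Finset.sum_mul, (hM _).2, one_mul, hμ.2]

/-- Telescoping bound for a sequence satisfying a damped recursion with decreasing step sizes. -/
lemma sum_le_of_damped_recursion {e a g : ℕ → ℝ} {M : ℝ} {n : ℕ}
    (ha : ∀ k, 1 ≤ k → 0 < a k) (hanti : ∀ k, 1 ≤ k → a (k + 1) ≤ a k)
    (he0 : ∀ k, 1 ≤ k → k ≤ n + 1 → 0 ≤ e k) (heM : ∀ k, 1 ≤ k → k ≤ n + 1 → e k ≤ M)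
    (hrec : ∀ k, 1 ≤ k → k ≤ n → e (k + 1) ≤ (1 - a (k + 1)) * e k + a (k + 1) * g k) :
    ∑ k ∈ Finset.Icc 1 n, e k ≤ M / a (n + 1) + ∑ k ∈ Finset.Icc 1 n, g k := by
  have key : ∀ m, m ≤ n → ∑ k ∈ Finset.Icc 1 m, e k
      ≤ (M - e (m + 1)) / a (m + 1) + ∑ k ∈ Finset.Icc 1 m, g k := by
    intro m
    induction m with
    | zero =>
      intro _
      simpa using div_nonneg (sub_nonneg.2 (heM 1 le_rfl (by omega))) (ha 1 le_rfl).le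
    | succ m ih =>
      intro hm
      rw [Finset.sum_Icc_succ_top (by omega), Finset.sum_Icc_succ_top (by omega)]
      have h1 := ih (by omega)
      have hpos := ha (m + 1 + 1) (by omega)
      have h2 : (M - e (m + 1)) / a (m + 1) ≤ (M - e (m + 1)) / a (m + 1 + 1) :=
        div_le_div_of_nonneg_left (sub_nonneg.2 (heM _ (by omega) (by omega))) hpos
          (hanti _ (by omega))
      have h3 : e (m + 1) ≤ (e (m + 1) - e (m + 1 + 1)) / a (m + 1 + 1) + g (m + 1) := by
        rw [← sub_le_iff_le_add, le_div_iff₀ hpos]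
        linarith [hrec (m + 1) (by omega) hm]
      have h4 : (M - e (m + 1 + 1)) / a (m + 1 + 1) = (M - e (m + 1)) / a (m + 1 + 1)
          + (e (m + 1) - e (m + 1 + 1)) / a (m + 1 + 1) := by ring
      linarith
  refine (key n le_rfl).trans ?_
  gcongr
  · exact (ha _ (by omega)).le
  · linarith [he0 (n + 1) (by omega) le_rfl]

lemma sum_rpow_sub_one_le {p : ℝ} (hp0 : 0 < p) (hp1 : p ≤ 1) (n : ℕ) :
    ∑ k ∈ Finset.Icc 1 n, (k : ℝ) ^ (p - 1) ≤ (n : ℝ) ^ p / p := by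
  induction n with
  | zero => simp [Real.zero_rpow hp0.ne']
  | succ n ih =>
    rw [Finset.sum_Icc_succ_top (by omega)]
    have hn : (0 : ℝ) < ((n + 1 : ℕ) : ℝ) := by positivity
    have hx : -1 ≤ -(1 / ((n + 1 : ℕ) : ℝ)) := by
      rw [neg_le_neg_iff, div_le_one hn]
      push_cast
      linarith [n.cast_nonneg (α := ℝ)]
    have hB := rpow_one_add_le_one_add_mul_self hx hp0.le hp1
    have hsplit : (n : ℝ) = ((n + 1 : ℕ) : ℝ) * (1 + -(1 / ((n + 1 : ℕ) : ℝ))) := by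
      field_simp
      push_cast
      ring
    have hstep : (n : ℝ) ^ p ≤ ((n + 1 : ℕ) : ℝ) ^ p - p * ((n + 1 : ℕ) : ℝ) ^ (p - 1) := by
      calc (n : ℝ) ^ p = ((n + 1 : ℕ) : ℝ) ^ p * (1 + -(1 / ((n + 1 : ℕ) : ℝ))) ^ p := by
            rw [← Real.mul_rpow hn.le (by linarith), ← hsplit]
        _ ≤ ((n + 1 : ℕ) : ℝ) ^ p * (1 + p * -(1 / ((n + 1 : ℕ) : ℝ))) := by gcongr
        _ = _ := by rw [Real.rpow_sub_one hn.ne']; ring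
    rw [le_div_iff₀ hp0] at ih ⊢
    nlinarith

lemma natCast_rpow_neg_le_two_mul {θ : ℝ} (hθ0 : 0 ≤ θ) (hθ1 : θ ≤ 1) {k : ℕ} (hk : 1 ≤ k) :
    (k : ℝ) ^ (-θ) ≤ 2 * ((k : ℝ) + 1) ^ (-θ) := by
  have hk' : (1 : ℝ) ≤ k := by exact_mod_cast hk
  have h2 : (2 : ℝ) ^ θ ≤ 2 := by
    simpa using Real.rpow_le_rpow_of_exponent_le (by norm_num : (1 : ℝ) ≤ 2) hθ1
  have h1 : ((k : ℝ) + 1) ^ θ ≤ 2 * (k : ℝ) ^ θ := by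
    calc ((k : ℝ) + 1) ^ θ ≤ (2 * k) ^ θ := by gcongr; linarith
      _ = 2 ^ θ * (k : ℝ) ^ θ := Real.mul_rpow (by norm_num) (by linarith)
      _ ≤ 2 * (k : ℝ) ^ θ := by gcongr
  rw [Real.rpow_neg (by linarith), Real.rpow_neg (by linarith), ← div_eq_mul_inv,
    inv_eq_one_div, div_le_div_iff₀ (by positivity) (by positivity)]
  linarith

/-- One step of the damped policy update, compared with moving targets `G` and `G'`. -/
lemma tvNorm_policy_update_le {S A : Type*} [Fintype S] [Fintype A] [Nonempty S]
    {po po' D G G' X : S → A → ℝ} {U : A → ℝ} {α ψ η : ℝ}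
    (hα0 : 0 ≤ α) (hα1 : α ≤ 1) (hψ : 0 ≤ ψ) (hX : isPolicy X) (hU : isSimplex U)
    (hupd : ∀ s a, po' s a
      = (1 - α) * (po s a + D s a) + α * ((1 - ψ) * X s a + ψ * U a))
    (hXG : ∀ s, ∑ a, |X s a - G' s a| ≤ η) :
    tvNorm (fun s a => po' s a - G' s a)
      ≤ (1 - α) * tvNorm (fun s a => po s a - G s a) + tvNorm D
        + tvNorm (fun s a => G s a - G' s a) + α * (η + 2 * ψ) := by
  refine tvNorm_le fun s => ?_
  have hα1' : 0 ≤ 1 - α := sub_nonneg.2 hα1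
  have hpt : ∀ a, |po' s a - G' s a| ≤ (1 - α) * |po s a - G s a| + |D s a|
      + |G s a - G' s a| + α * (|X s a - G' s a| + ψ * |U a - X s a|) := by
    intro a
    have hEq : po' s a - G' s a = (1 - α) * (po s a - G s a) + (1 - α) * D s a
        + (1 - α) * (G s a - G' s a) + α * ((X s a - G' s a) + ψ * (U a - X s a)) := by
      rw [hupd]; ring
    have hshrink : ∀ x : ℝ, |(1 - α) * x| ≤ |x| := fun x => by
      rw [abs_mul, abs_of_nonneg hα1']
      exact mul_le_of_le_one_left (abs_nonneg _) (by linarith)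
    have hlast : |α * ((X s a - G' s a) + ψ * (U a - X s a))|
        ≤ α * (|X s a - G' s a| + ψ * |U a - X s a|) := by
      rw [abs_mul, abs_of_nonneg hα0]
      gcongr
      refine (abs_add_le _ _).trans_eq ?_
      rw [abs_mul ψ, abs_of_nonneg hψ]
    rw [hEq]
    refine (abs_add_le _ _).trans (add_le_add ((abs_add_le _ _).trans (add_le_add
      ((abs_add_le _ _).trans (add_le_add ?_ (hshrink _))) (hshrink _))) hlast)
    rw [abs_mul, abs_of_nonneg hα1']
  calc ∑ a, |po' s a - G' s a|
      ≤ ∑ a, ((1 - α) * |po s a - G s a| + |D s a|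
        + |G s a - G' s a| + α * (|X s a - G' s a| + ψ * |U a - X s a|)) :=
        Finset.sum_le_sum fun a _ => hpt a
    _ = (1 - α) * ∑ a, |po s a - G s a| + ∑ a, |D s a| + ∑ a, |G s a - G' s a|
        + α * (∑ a, |X s a - G' s a| + ψ * ∑ a, |U a - X s a|) := by
        simp only [Finset.sum_add_distrib, ← Finset.mul_sum]
    _ ≤ _ := by
        have h1 := sum_abs_le_tvNorm (fun s a => po s a - G s a) s
        have h2 := sum_abs_le_tvNorm D s
        have h3 := sum_abs_le_tvNorm (fun s a => G s a - G' s a) s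
        have h4 := hXG s
        have h5 := mul_le_mul_of_nonneg_left (hU.sum_abs_sub_le_two (hX s)) hψ
        have h6 : ∑ a, |X s a - G' s a| + ψ * ∑ a, |U a - X s a| ≤ η + 2 * ψ := by linarith
        gcongr

/-- The mean-field iterate moves by at most a multiple of the step size. -/
lemma l1Norm_sub_meanField_update_le {S : Type*} [Fintype S] {M : S → S → ℝ} {μ μ' D : S → ℝ}
    {β ε : ℝ} (hβ0 : 0 ≤ β) (hM : ∀ s, isSimplex (M s)) (hμD : isSimplex (fun s => μ s + D s))
    (hupd : l1Norm (fun s => μ' s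
      - ((1 - β) * (μ s + D s) + β * ∑ s', M s' s * (μ s' + D s'))) ≤ ε) :
    l1Norm (fun s => μ s - μ' s) ≤ l1Norm D + 2 * β + ε := by
  have h2 := (hμD.sum_mul hM).sum_abs_sub_le_two hμD
  have hpt : ∀ s, |μ s - μ' s| ≤ |D s| + β * |∑ s', M s' s * (μ s' + D s') - (μ s + D s)|
      + |μ' s - ((1 - β) * (μ s + D s) + β * ∑ s', M s' s * (μ s' + D s'))| := by
    intro s
    have hEq : μ s - μ' s = -D s + -(β * (∑ s', M s' s * (μ s' + D s') - (μ s + D s)))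
        + -(μ' s - ((1 - β) * (μ s + D s) + β * ∑ s', M s' s * (μ s' + D s'))) := by ring
    rw [hEq]
    refine (abs_add_le _ _).trans (add_le_add ((abs_add_le _ _).trans (add_le_add ?_ ?_)) ?_)
    · rw [abs_neg]
    · rw [abs_neg, abs_mul, abs_of_nonneg hβ0]
    · rw [abs_neg]
  calc l1Norm (fun s => μ s - μ' s)
      ≤ ∑ s, (|D s| + β * |∑ s', M s' s * (μ s' + D s') - (μ s + D s)|
      + |μ' s - ((1 - β) * (μ s + D s) + β * ∑ s', M s' s * (μ s' + D s'))|) :=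
        Finset.sum_le_sum fun s _ => hpt s
    _ = l1Norm D + β * ∑ s, |∑ s', M s' s * (μ s' + D s') - (μ s + D s)|
      + l1Norm (fun s => μ' s
      - ((1 - β) * (μ s + D s) + β * ∑ s', M s' s * (μ s' + D s'))) := by
        simp only [Finset.sum_add_distrib, ← Finset.mul_sum, l1Norm]
    _ ≤ _ := by
        have := mul_le_mul_of_nonneg_left h2 hβ0
        linarith

/-- One step of the damped mean-field update, compared with a fixed point. -/
lemma l1Norm_meanField_update_le {S : Type*} [Fintype S] {M N : S → S → ℝ} {μ μ' D μs : S → ℝ}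
    {β ε εM c : ℝ} (hβ0 : 0 ≤ β) (hβ1 : β ≤ 1) (hM : ∀ s, isSimplex (M s)) (hμ : isSimplex μ)
    (hupd : l1Norm (fun s => μ' s
      - ((1 - β) * (μ s + D s) + β * ∑ s', M s' s * (μ s' + D s'))) ≤ ε)
    (hMN : ∀ s', ∑ s, |M s' s - N s' s| ≤ εM)
    (hN : l1Norm (fun s => ∑ s', N s' s * μ s' - μs s) ≤ c) :
    l1Norm (fun s => μ' s - μs s)
      ≤ (1 - β) * l1Norm (fun s => μ s - μs s) + l1Norm D + β * (εM + c) + ε := by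
  have hD := sum_abs_sum_mul_le (v := D) fun s' => (hM s').sum_abs.le
  have hE := sum_abs_sum_mul_le (v := μ) hMN
  rw [l1Norm, hμ.sum_abs] at hE
  have hpt : ∀ s, |μ' s - μs s| ≤ (1 - β) * |μ s - μs s| + (1 - β) * |D s|
      + β * (|∑ s', M s' s * D s'| + |∑ s', (M s' s - N s' s) * μ s'|
        + |∑ s', N s' s * μ s' - μs s|)
      + |μ' s - ((1 - β) * (μ s + D s) + β * ∑ s', M s' s * (μ s' + D s'))| := by
    intro s
    have hEq : μ' s - μs s = (1 - β) * (μ s - μs s) + (1 - β) * D s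
        + β * (∑ s', M s' s * D s' + ∑ s', (M s' s - N s' s) * μ s'
          + (∑ s', N s' s * μ s' - μs s))
        + (μ' s - ((1 - β) * (μ s + D s) + β * ∑ s', M s' s * (μ s' + D s'))) := by
      simp only [mul_add, sub_mul, Finset.sum_add_distrib, Finset.sum_sub_distrib]
      ring
    rw [hEq]
    refine (abs_add_le _ _).trans (add_le_add_left ((abs_add_le _ _).trans (add_le_add
      ((abs_add_le _ _).trans (add_le_add ?_ ?_)) ?_)) _)
    · rw [abs_mul, abs_of_nonneg (sub_nonneg.2 hβ1)]
    · rw [abs_mul, abs_of_nonneg (sub_nonneg.2 hβ1)]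
    · rw [abs_mul, abs_of_nonneg hβ0]
      gcongr
      exact abs_add_three _ _ _
  calc l1Norm (fun s => μ' s - μs s) ≤ _ := Finset.sum_le_sum fun s _ => hpt s
    _ = (1 - β) * l1Norm (fun s => μ s - μs s) + (1 - β) * l1Norm D
      + β * (∑ s, |∑ s', M s' s * D s'| + ∑ s, |∑ s', (M s' s - N s' s) * μ s'|
        + l1Norm (fun s => ∑ s', N s' s * μ s' - μs s))
      + l1Norm (fun s => μ' s
        - ((1 - β) * (μ s + D s) + β * ∑ s', M s' s * (μ s' + D s'))) := by
        simp only [Finset.sum_add_distrib, ← Finset.mul_sum, l1Norm]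
    _ ≤ (1 - β) * l1Norm (fun s => μ s - μs s) + (1 - β) * l1Norm D
      + β * (1 * l1Norm D + εM * 1 + c) + ε := by gcongr
    _ = _ := by ring

/-- Averaging the damped policy recursion with step sizes `cpi * k ^ (-θ)`. -/
lemma average_policy_error_le {d1 cpi cμ θ γ δ ε εQ ψ : ℝ} {e : ℕ → ℝ} {n : ℕ}
    (hd1 : 0 ≤ d1) (hcpi : 0 < cpi) (hcμ1 : cμ ≤ 1)
    (hθ : 0 < θ) (hθγ : θ < γ) (hγ : γ < 1) (hδ : 0 ≤ δ) (hε : 0 ≤ ε) (hεQ : 0 ≤ εQ)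
    (hψ : ψ ≤ ε / 4) (he0 : ∀ k, 1 ≤ k → k ≤ n + 1 → 0 ≤ e k)
    (he2 : ∀ k, 1 ≤ k → k ≤ n + 1 → e k ≤ 2)
    (hrec : ∀ k, 1 ≤ k → k ≤ n → e (k + 1) ≤ (1 - cpi * ((k : ℝ) + 1) ^ (-θ)) * e k
      + 2 * (cpi * ((k : ℝ) + 1) ^ (-θ)) * δ
      + d1 * ((cμ * ((k : ℝ) + 1) ^ (-γ)) * (2 + 2 * δ + ε))
      + cpi * ((k : ℝ) + 1) ^ (-θ) * (4 * εQ + 2 * ψ)) :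
    1 / ((n + 1 : ℕ) : ℝ) * ∑ k ∈ Finset.Icc 1 n, e k
      ≤ (2 / cpi + 4 + 2 * d1 / cpi * (1 + 1 / (1 + θ - γ)))
        * (((n + 1 : ℕ) : ℝ) ^ (θ - 1) + εQ + ((n + 1 : ℕ) : ℝ) ^ (θ - γ) + δ + ε) := by
  set K : ℝ := ((n + 1 : ℕ) : ℝ) with hK
  have hK0 : 0 < K := by positivity
  have hp : 0 < 1 + θ - γ := by linarith
  set B : ℝ := 2 * δ + (4 * εQ + 2 * ψ) + d1 / cpi * (2 * δ + ε) with hB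
  have hB0 : 0 ≤ d1 / cpi := by positivity
  have hsum := sum_le_of_damped_recursion (e := e) (a := fun k => cpi * (k : ℝ) ^ (-θ))
    (g := fun k => B + 2 * d1 / cpi * ((k : ℝ) + 1) ^ (θ - γ)) (M := 2) (n := n)
    (fun k hk => by
      have : (0 : ℝ) < k := by exact_mod_cast hk
      positivity)
    (fun k hk => by
      have : (0 : ℝ) < k := by exact_mod_cast hk
      have := Real.rpow_le_rpow_of_nonpos this (by push_cast; linarith : (k : ℝ) ≤ (k + 1 : ℕ))
        (by linarith : -θ ≤ 0)
      gcongr)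
    he0 he2
    (fun k hk hkn => by
      refine (hrec k hk hkn).trans ?_
      push_cast
      have hk1 : (1 : ℝ) ≤ (k : ℝ) + 1 := by linarith [k.cast_nonneg (α := ℝ)]
      set x := ((k : ℝ) + 1) ^ (-θ) with hx
      set y := ((k : ℝ) + 1) ^ (θ - γ) with hy
      have hx0 : 0 ≤ x := by positivity
      have hy0 : 0 ≤ y := by positivity
      have hy1 : y ≤ 1 := Real.rpow_le_one_of_one_le_of_nonpos hk1 (by linarith)
      have hxy : ((k : ℝ) + 1) ^ (-γ) = x * y := by
        rw [hx, hy, ← Real.rpow_add (by linarith)]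
        ring_nf
      rw [hxy]
      have h1 : d1 * (cμ * (x * y) * (2 + 2 * δ + ε)) ≤ d1 * (1 * (x * y) * (2 + 2 * δ + ε)) := by
        gcongr
      have h2 : x * d1 * (2 * δ + ε) * y ≤ x * d1 * (2 * δ + ε) * 1 := by gcongr
      have h3 : cpi * x * (B + 2 * d1 / cpi * y)
          = 2 * (cpi * x) * δ + cpi * x * (4 * εQ + 2 * ψ) + x * d1 * (2 * δ + ε) * 1
            + 2 * (x * y) * d1 := by
        rw [hB]; field_simp
      linarith)
  have hshift : ∑ k ∈ Finset.Icc 1 n, ((k : ℝ) + 1) ^ (θ - γ) ≤ K ^ (1 + θ - γ) / (1 + θ - γ) := by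
    have h1 : ∑ k ∈ Finset.Icc 1 n, ((k : ℝ) + 1) ^ (θ - γ)
        ≤ ∑ k ∈ Finset.Icc 1 n, (k : ℝ) ^ (1 + θ - γ - 1) := by
      refine Finset.sum_le_sum fun k hk => ?_
      have : (0 : ℝ) < k := by exact_mod_cast (Finset.mem_Icc.1 hk).1
      rw [show 1 + θ - γ - 1 = θ - γ by ring]
      exact Real.rpow_le_rpow_of_nonpos this (by linarith) (by linarith)
    refine h1.trans ((sum_rpow_sub_one_le hp (by linarith) n).trans ?_)
    gcongr
    rw [hK]; push_cast; linarith
  rw [Finset.sum_add_distrib, ← Finset.mul_sum, Finset.sum_const, Nat.card_Icc, nsmul_eq_mul,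
    Nat.add_sub_cancel, ← hK] at hsum
  have hnK : (n : ℝ) ≤ K := by rw [hK]; push_cast; linarith
  have hBle : B ≤ 2 * δ + 4 * εQ + ε / 2 + d1 / cpi * (2 * δ + ε) := by rw [hB]; linarith
  set B' := 2 * δ + 4 * εQ + ε / 2 + d1 / cpi * (2 * δ + ε) with hB'
  have hB'0 : 0 ≤ B' := by positivity
  have hsum' : ∑ k ∈ Finset.Icc 1 n, e k
      ≤ K * (2 / cpi * K ^ (θ - 1) + B' + 2 * d1 / cpi * (1 / (1 + θ - γ)) * K ^ (θ - γ)) := by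
    calc ∑ k ∈ Finset.Icc 1 n, e k
        ≤ 2 / (cpi * K ^ (-θ)) + (K * B' + 2 * d1 / cpi * (K ^ (1 + θ - γ) / (1 + θ - γ))) := by
          refine hsum.trans ?_
          refine add_le_add le_rfl (add_le_add ?_ (by gcongr))
          exact (mul_le_mul_of_nonneg_left hBle n.cast_nonneg).trans
            (mul_le_mul_of_nonneg_right hnK hB'0)
      _ = _ := by
          have e1 : K ^ (-θ) = (K * K ^ (θ - 1))⁻¹ := by
            rw [Real.rpow_sub_one hK0.ne', mul_div_cancel₀ _ hK0.ne', Real.rpow_neg hK0.le]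
          have e2 : K ^ (1 + θ - γ) = K * K ^ (θ - γ) := by
            rw [show 1 + θ - γ = 1 + (θ - γ) by ring, Real.rpow_add hK0, Real.rpow_one]
          rw [e1, e2]
          have := (Real.rpow_pos_of_pos hK0 (θ - 1)).ne'
          field_simp
          ring
  have hx0 : 0 ≤ K ^ (θ - 1) := by positivity
  have hy0 : 0 ≤ K ^ (θ - γ) := by positivity
  have hq0 : 0 ≤ 1 / (1 + θ - γ) := by positivity
  have hc0 : 0 ≤ 2 / cpi := by positivity
  rw [one_div, inv_mul_le_iff₀ hK0]
  refine hsum'.trans (mul_le_mul_of_nonneg_left ?_ hK0.le)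
  set r := d1 / cpi with hr
  set q := 1 / (1 + θ - γ)
  rw [hB', show 2 * d1 / cpi = 2 * r by rw [hr]; ring]
  have hrq : 0 ≤ r * q := by positivity
  nlinarith [mul_nonneg hc0 hεQ, mul_nonneg hc0 hy0, mul_nonneg hc0 hδ, mul_nonneg hc0 hε,
    mul_nonneg hB0 hεQ, mul_nonneg hB0 hy0, mul_nonneg hB0 hδ, mul_nonneg hB0 hε,
    mul_nonneg hB0 hx0, mul_nonneg hrq hεQ, mul_nonneg hrq hx0, mul_nonneg hrq hδ,
    mul_nonneg hrq hε]

/-- Averaging the damped mean-field recursion with step sizes `cμ * k ^ (-γ)`. -/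
lemma average_meanField_error_le {d d2 cμ γ B X : ℝ} {e f : ℕ → ℝ} {n : ℕ}
    (hd : d < 1) (hd2 : 0 ≤ d2) (hcμ : 0 < cμ) (hγ : 0 < γ) (hB : 0 ≤ B)
    (hf0 : ∀ k, 1 ≤ k → k ≤ n + 1 → 0 ≤ f k) (hf2 : ∀ k, 1 ≤ k → k ≤ n + 1 → f k ≤ 2)
    (hX : 1 / ((n + 1 : ℕ) : ℝ) * ∑ k ∈ Finset.Icc 1 n, e k ≤ X)
    (hrec : ∀ k, 1 ≤ k → k ≤ n → f (k + 1) ≤ (1 - cμ * ((k : ℝ) + 1) ^ (-γ) * (1 - d)) * f k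
      + cμ * ((k : ℝ) + 1) ^ (-γ) * (d2 * e k + B)) :
    1 / ((n + 1 : ℕ) : ℝ) * ∑ k ∈ Finset.Icc 1 n, f k
      ≤ (2 / cμ * ((n + 1 : ℕ) : ℝ) ^ (γ - 1) + d2 * X + B) / (1 - d) := by
  set K : ℝ := ((n + 1 : ℕ) : ℝ) with hK
  have hK0 : 0 < K := by positivity
  have hd' : 0 < 1 - d := sub_pos.2 hd
  have hsum := sum_le_of_damped_recursion (e := f) (a := fun k => cμ * (k : ℝ) ^ (-γ) * (1 - d))
    (g := fun k => (d2 * e k + B) / (1 - d)) (M := 2) (n := n)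
    (fun k hk => by
      have : (0 : ℝ) < k := by exact_mod_cast hk
      positivity)
    (fun k hk => by
      have : (0 : ℝ) < k := by exact_mod_cast hk
      have := Real.rpow_le_rpow_of_nonpos this (by push_cast; linarith : (k : ℝ) ≤ (k + 1 : ℕ))
        (by linarith : -γ ≤ 0)
      gcongr)
    hf0 hf2
    (fun k hk hkn => by
      refine (hrec k hk hkn).trans_eq ?_
      push_cast
      field_simp)
  rw [← Finset.sum_div, Finset.sum_add_distrib, ← Finset.mul_sum, Finset.sum_const, Nat.card_Icc,
    nsmul_eq_mul, Nat.add_sub_cancel, ← hK] at hsum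
  have hnK : (n : ℝ) ≤ K := by rw [hK]; push_cast; linarith
  rw [one_div, inv_mul_le_iff₀ hK0] at hX ⊢
  have e1 : K ^ (-γ) = (K * K ^ (γ - 1))⁻¹ := by
    rw [Real.rpow_sub_one hK0.ne', mul_div_cancel₀ _ hK0.ne', Real.rpow_neg hK0.le]
  calc ∑ k ∈ Finset.Icc 1 n, f k
      ≤ 2 / (cμ * K ^ (-γ) * (1 - d)) + (d2 * (K * X) + K * B) / (1 - d) := by
        refine hsum.trans ?_
        gcongr
    _ = _ := by
        rw [e1]
        have := (Real.rpow_pos_of_pos hK0 (γ - 1)).ne'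
        field_simp
        ring

/-- deterministic form of Theorem 1: under the contraction assumption
and the Algorithm hypotheses, there is a constant `C > 0` depending only on
`|𝒮|, |𝒜|, d₁, d₂, d₃, c_π, c_μ, θ, γ` such that the time-averaged policy error and
mean-field error satisfy
`(1/K) Σ_{k=1}^{K−1} e^k_π ≤ C (K^{θ−1} + ε_Q + K^{θ−γ} + δ + ε)` and
`(1/K) Σ_{k=1}^{K−1} e^k_μ ≤ C (K^{γ−1} + ε + ε_P + ε_Q + K^{θ−1} + K^{θ−γ} + δ)`. -/
theorem sandbox_theorem_one {S A : Type*} [Fintype S] [Fintype A] [Nonempty S] [Nonempty A]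
    (d1 d2 d3 : ℝ) (hd1 : 0 ≤ d1) (hd2 : 0 ≤ d2) (hd3 : 0 ≤ d3)
    (hd : d1 * d2 + d3 < 1)
    (cpi cμ : ℝ) (hcpi : cpi ∈ Set.Ioc (0 : ℝ) 1) (hcμ : cμ ∈ Set.Ioc (0 : ℝ) 1)
    (θ γ : ℝ) (hθ : 0 < θ) (hθγ : θ < γ) (hγ : γ < 1) :
    ∃ C : ℝ, 0 < C ∧
      ∀ (P : S → A → (S → ℝ) → S → ℝ) (R : S → A → (S → ℝ) → ℝ)
        (ρ lam : ℝ) (Qstar : (S → ℝ) → S → A → ℝ)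
        (K : ℕ) (ε δ εP εQ ψ εnet : ℝ)
        (μseq : ℕ → S → ℝ) (piSeq : ℕ → S → A → ℝ)
        (Phat : ℕ → S → S → ℝ) (Qk : ℕ → S → A → ℝ)
        (Δμ : ℕ → S → ℝ) (Dpi : ℕ → S → A → ℝ)
        (piStar : S → A → ℝ) (μstar : S → ℝ),
        -- game data
        (∀ s a μ, isSimplex μ → isSimplex (P s a μ)) →
        (∀ s a μ, isSimplex μ → R s a μ ∈ Set.Icc (0 : ℝ) 1) →
        ρ ∈ Set.Ioo (0 : ℝ) 1 → 0 < lam →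
        -- Q*_μ is the fixed point of the Bellman operator of the MDP induced by μ
        (∀ μ, isSimplex μ → ∀ s a,
          Qstar μ s a = R s a μ + ρ * ∑ s',
            P s a μ s' * Finset.univ.sup' Finset.univ_nonempty (fun a' => Qstar μ s' a')) →
        -- Assumption 1 (contraction)
        (∀ μ μ', isSimplex μ → isSimplex μ' →
          tvNorm (fun s a => softmaxPol lam (Qstar μ) s a - softmaxPol lam (Qstar μ') s a)
            ≤ d1 * l1Norm (fun s => μ s - μ' s)) →
        (∀ po po' μ, isPolicy po → isPolicy po' → isSimplex μ →
          l1Norm (fun s' => gamma2 P po μ s' - gamma2 P po' μ s')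
            ≤ d2 * tvNorm (fun s a => po s a - po' s a)) →
        (∀ po μ μ', isPolicy po → isSimplex μ → isSimplex μ' →
          l1Norm (fun s' => gamma2 P po μ s' - gamma2 P po μ' s')
            ≤ d3 * l1Norm (fun s => μ s - μ' s)) →
        -- (π*, μ*) is a B-MFE
        isPolicy piStar → isSimplex μstar →
        (∀ s a, piStar s a = softmaxPol lam (Qstar μstar) s a) →
        (∀ s', μstar s' = gamma2 P piStar μstar s') →
        -- algorithm scalars
        2 ≤ K → 0 < ε → 0 ≤ δ → 0 ≤ εP → 0 ≤ εQ →
        ψ ∈ Set.Icc (0 : ℝ) (ε / 4) →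
        0 ≤ εnet → εnet ≤ cμ * (1 - (d1 * d2 + d3)) * ε * (K : ℝ) ^ (-γ) →
        -- iterates are well-formed
        (∀ k, 1 ≤ k → k ≤ K → isSimplex (μseq k)) →
        (∀ k, 1 ≤ k → k ≤ K → isPolicy (piSeq k)) →
        (∀ k, 1 ≤ k → k ≤ K → ∀ s, isSimplex (Phat k s)) →
        (∀ k, 1 ≤ k → k ≤ K - 1 → isSimplex (fun s => μseq k s + Δμ k s)) →
        (∀ k, 1 ≤ k → k ≤ K - 1 → isPolicy (fun s a => piSeq k s a + Dpi k s a)) →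
        -- (i) policy update
        (∀ k, 1 ≤ k → k ≤ K - 1 → ∀ s a,
          piSeq (k + 1) s a
            = (1 - cpi * ((k : ℝ) + 1) ^ (-θ)) * (piSeq k s a + Dpi k s a)
              + cpi * ((k : ℝ) + 1) ^ (-θ)
                * ((1 - ψ) * softmaxPol lam (Qk (k + 1)) s a
                   + ψ * (1 / (Fintype.card A : ℝ)))) →
        -- (ii) mean-field update up to projection error ε_net
        (∀ k, 1 ≤ k → k ≤ K - 1 →
          l1Norm (fun s => μseq (k + 1) s
            - ((1 - cμ * ((k : ℝ) + 1) ^ (-γ)) * (μseq k s + Δμ k s)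
               + cμ * ((k : ℝ) + 1) ^ (-γ)
                 * ∑ s', Phat k s' s * (μseq k s' + Δμ k s'))) ≤ εnet) →
        -- (iii) drift bounds
        (∀ k, 1 ≤ k → k ≤ K - 1 → tvNorm (Dpi k) ≤ cpi * (k : ℝ) ^ (-θ) * δ) →
        (∀ k, 1 ≤ k → k ≤ K - 1 → l1Norm (Δμ k) ≤ cμ * (k : ℝ) ^ (-γ) * δ) →
        -- (iv) transition-matrix estimation error
        (∀ k, 1 ≤ k → k ≤ K →
          frobNorm (fun s s' => Phat k s s' - transMat P (piSeq k) (μseq k) s s') ≤ εP) →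
        -- (v) Q-function estimation error
        (∀ k, 1 ≤ k → k ≤ K → ∀ s a, |Qk k s a - Qstar (μseq k) s a| ≤ εQ / lam) →
        -- conclusion
        (1 / (K : ℝ)) * (∑ k ∈ Finset.Icc 1 (K - 1),
            tvNorm (fun s a => piSeq k s a - softmaxPol lam (Qstar (μseq k)) s a))
          ≤ C * ((K : ℝ) ^ (θ - 1) + εQ + (K : ℝ) ^ (θ - γ) + δ + ε)
        ∧ (1 / (K : ℝ)) * (∑ k ∈ Finset.Icc 1 (K - 1),
            l1Norm (fun s => μseq k s - μstar s))
          ≤ C * ((K : ℝ) ^ (γ - 1) + ε + εP + εQ + (K : ℝ) ^ (θ - 1)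
                  + (K : ℝ) ^ (θ - γ) + δ) := by
  have hcpi0 := hcpi.1
  have hcμ0 := hcμ.1
  set d := d1 * d2 + d3 with hd_def
  have hd' : 0 < 1 - d := sub_pos.2 hd
  set Cpi : ℝ := 2 / cpi + 4 + 2 * d1 / cpi * (1 + 1 / (1 + θ - γ)) with hCpi
  have hp : 0 < 1 + θ - γ := by linarith
  have hCpi0 : 0 < Cpi := by positivity
  set m : ℝ := (Fintype.card S : ℝ) with hm
  set Cμ : ℝ := (2 / cμ + d2 * Cpi + m + 3) / (1 - d) with hCμ
  have hCμ0 : 0 < Cμ := by positivity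
  refine ⟨Cpi + Cμ, by positivity, ?_⟩
  intro P R ρ lam Qstar K ε δ εP εQ ψ εnet μseq piSeq Phat Qk Δμ Dpi piStar μstar _ _ _ hlam _
    hΓ1 hΓ2pi hΓ2μ hpiStar hμstar hpiStar_eq hμstar_eq hK hε hδ hεP hεQ hψ _ hεnet hμ hpi hPhat
    hμΔ _ hpiUpd hμUpd hDpi hΔμ hP hQ
  obtain ⟨n, rfl⟩ : ∃ n, K = n + 1 := ⟨K - 1, by omega⟩
  rw [Nat.add_sub_cancel] at *
  set X : ℝ := ((n + 1 : ℕ) : ℝ) ^ (θ - 1) + εQ + ((n + 1 : ℕ) : ℝ) ^ (θ - γ) + δ + ε with hX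
  have hX0 : 0 ≤ X := by positivity
  have hsmall : ∀ {c x : ℝ}, 0 < x → c ∈ Set.Ioc (0 : ℝ) 1 → ∀ k : ℕ,
      0 ≤ c * ((k : ℝ) + 1) ^ (-x) ∧ c * ((k : ℝ) + 1) ^ (-x) ≤ 1 := fun {c x} hx hc k => by
    have hc0 := hc.1
    have : ((k : ℝ) + 1) ^ (-x) ≤ 1 := Real.rpow_le_one_of_one_le_of_nonpos
      (by linarith [k.cast_nonneg (α := ℝ)]) (by linarith)
    exact ⟨by positivity, mul_le_one₀ hc.2 (by positivity) this⟩
  have hdrift : ∀ {c x : ℝ}, 0 < x → x < 1 → 0 < c → ∀ k : ℕ, 1 ≤ k →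
      c * (k : ℝ) ^ (-x) * δ ≤ 2 * (c * ((k : ℝ) + 1) ^ (-x)) * δ := fun {c x} hx hx1 hc k hk => by
    have := natCast_rpow_neg_le_two_mul hx.le hx1.le hk
    calc c * (k : ℝ) ^ (-x) * δ ≤ c * (2 * ((k : ℝ) + 1) ^ (-x)) * δ := by gcongr
      _ = _ := by ring
  have hnet : ∀ k, 1 ≤ k → k ≤ n → εnet ≤ cμ * ((k : ℝ) + 1) ^ (-γ) * ((1 - d) * ε) := by
    intro k _ hkn
    have : (((n + 1 : ℕ) : ℝ)) ^ (-γ) ≤ ((k : ℝ) + 1) ^ (-γ) := by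
      refine Real.rpow_le_rpow_of_nonpos (by positivity) ?_ (by linarith)
      exact_mod_cast Nat.succ_le_succ hkn
    calc εnet ≤ cμ * (1 - d) * ε * ((n + 1 : ℕ) : ℝ) ^ (-γ) := hεnet
      _ ≤ cμ * (1 - d) * ε * ((k : ℝ) + 1) ^ (-γ) := by gcongr
      _ = _ := by ring
  have hd0 : 0 ≤ d := by positivity
  have hpolicy : 1 / ((n + 1 : ℕ) : ℝ) * ∑ k ∈ Finset.Icc 1 n,
      tvNorm (fun s a => piSeq k s a - softmaxPol lam (Qstar (μseq k)) s a) ≤ Cpi * X := by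
    refine average_policy_error_le (cμ := cμ) (ψ := ψ) hd1 hcpi0 hcμ.2 hθ hθγ hγ hδ hε.le hεQ
      hψ.2 (fun k _ _ => tvNorm_nonneg _)
      (fun k hk hkn => tvNorm_le fun s => (hpi k hk hkn s).sum_abs_sub_le_two
        (isPolicy_softmaxPol lam _ s)) ?_
    intro k hk hkn
    obtain ⟨ha0, ha1⟩ := hsmall hθ hcpi k
    obtain ⟨hb0, -⟩ := hsmall (hθ.trans hθγ) hcμ k
    have hstep := tvNorm_policy_update_le (G := softmaxPol lam (Qstar (μseq k)))
      (G' := softmaxPol lam (Qstar (μseq (k + 1)))) (η := 4 * εQ) ha0 ha1 hψ.1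
      (isPolicy_softmaxPol lam (Qk (k + 1))) isSimplex_uniform (hpiUpd k hk hkn)
      (fun s => sum_abs_softmaxPol_sub_le fun a => by
        rw [← mul_sub, abs_mul, abs_of_pos hlam, mul_comm, ← le_div_iff₀ hlam]
        exact hQ (k + 1) (by omega) (by omega) s a)
    have hmove := l1Norm_sub_meanField_update_le hb0 (hPhat k hk (by omega)) (hμΔ k hk hkn)
      (hμUpd k hk hkn)
    have hmove' : l1Norm (fun s => μseq k s - μseq (k + 1) s)
        ≤ cμ * ((k : ℝ) + 1) ^ (-γ) * (2 + 2 * δ + ε) := by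
      have h1 := (hΔμ k hk hkn).trans (hdrift (hθ.trans hθγ) hγ hcμ0 k hk)
      have h2 : cμ * ((k : ℝ) + 1) ^ (-γ) * ((1 - d) * ε) ≤ cμ * ((k : ℝ) + 1) ^ (-γ) * ε :=
        mul_le_mul_of_nonneg_left (mul_le_of_le_one_left hε.le (by linarith)) hb0
      linarith [hnet k hk hkn]
    have h1 := (hDpi k hk hkn).trans (hdrift hθ (hθγ.trans hγ) hcpi0 k hk)
    have h2 := (hΓ1 (μseq k) (μseq (k + 1)) (hμ k hk (by omega))
      (hμ (k + 1) (by omega) (by omega))).trans (mul_le_mul_of_nonneg_left hmove' hd1)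
    linarith
  have hmeanField : 1 / ((n + 1 : ℕ) : ℝ) * ∑ k ∈ Finset.Icc 1 n,
      l1Norm (fun s => μseq k s - μstar s)
      ≤ (2 / cμ * ((n + 1 : ℕ) : ℝ) ^ (γ - 1) + d2 * (Cpi * X)
        + (m * εP + 2 * δ + (1 - d) * ε)) / (1 - d) := by
    refine average_meanField_error_le hd hd2 hcμ0 (hθ.trans hθγ) (by positivity)
      (fun k _ _ => l1Norm_nonneg _)
      (fun k hk hkn => (hμ k hk hkn).sum_abs_sub_le_two hμstar) hpolicy ?_
    intro k hk hkn
    have hkn' : k ≤ n + 1 := by omega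
    obtain ⟨hb0, hb1⟩ := hsmall (hθ.trans hθγ) hcμ k
    have hfix : l1Norm (fun s => ∑ s', transMat P (piSeq k) (μseq k) s' s * μseq k s' - μstar s)
        ≤ d2 * tvNorm (fun s a => piSeq k s a - softmaxPol lam (Qstar (μseq k)) s a)
          + d * l1Norm (fun s => μseq k s - μstar s) := by
      have h1 := hΓ2pi (piSeq k) piStar (μseq k) (hpi k hk hkn') hpiStar (hμ k hk hkn')
      have h2 := hΓ2μ piStar (μseq k) μstar hpiStar (hμ k hk hkn') hμstar
      have h3 := l1Norm_sub_le_add (gamma2 P (piSeq k) (μseq k)) (gamma2 P piStar (μseq k))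
        (gamma2 P piStar μstar)
      have h4 : tvNorm (fun s a => piSeq k s a - piStar s a)
          ≤ tvNorm (fun s a => piSeq k s a - softmaxPol lam (Qstar (μseq k)) s a)
            + d1 * l1Norm (fun s => μseq k s - μstar s) := by
        refine tvNorm_le fun s => ?_
        have h5 := sum_abs_le_tvNorm
          (fun s a => piSeq k s a - softmaxPol lam (Qstar (μseq k)) s a) s
        have h6 := (sum_abs_le_tvNorm (fun s a => softmaxPol lam (Qstar (μseq k)) s a
          - softmaxPol lam (Qstar μstar) s a) s).trans
          (hΓ1 (μseq k) μstar (hμ k hk hkn') hμstar)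
        have h7 := l1Norm_sub_le_add (piSeq k s) (softmaxPol lam (Qstar (μseq k)) s)
          (softmaxPol lam (Qstar μstar) s)
        simp only [l1Norm] at h6 h7 ⊢
        simp only [hpiStar_eq]
        linarith
      have h8 := mul_le_mul_of_nonneg_left h4 hd2
      simp only [← gamma2_eq_sum_transMat]
      simp only [← hμstar_eq] at h2 h3
      rw [hd_def]
      linarith
    have hstep := l1Norm_meanField_update_le (εM := m * εP) hb0 hb1 (hPhat k hk hkn')
      (hμ k hk hkn') (hμUpd k hk hkn)
      (N := transMat P (piSeq k) (μseq k))
      (fun s' => by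
        refine (Finset.sum_le_card_nsmul _ _ εP fun s _ => ?_).trans_eq
          (by rw [nsmul_eq_mul, Finset.card_univ])
        exact (abs_le_frobNorm (fun s s' => Phat k s s' - transMat P (piSeq k) (μseq k) s s')
          s' s).trans (hP k hk hkn'))
      hfix
    have h1 := (hΔμ k hk hkn).trans (hdrift (hθ.trans hθγ) hγ hcμ0 k hk)
    linarith [hnet k hk hkn]
  refine ⟨hpolicy.trans (mul_le_mul_of_nonneg_right (by linarith) hX0), hmeanField.trans ?_⟩
  set x := ((n + 1 : ℕ) : ℝ) ^ (γ - 1) with hx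
  set Y : ℝ := x + ε + εP + εQ + ((n + 1 : ℕ) : ℝ) ^ (θ - 1)
    + ((n + 1 : ℕ) : ℝ) ^ (θ - γ) + δ with hY
  have hx0 : 0 ≤ x := by positivity
  have hXY : X ≤ Y := by rw [hX, hY]; linarith
  have hrest : x + εP + δ + ε ≤ Y := by
    have : 0 ≤ ((n + 1 : ℕ) : ℝ) ^ (θ - 1) := by positivity
    have : 0 ≤ ((n + 1 : ℕ) : ℝ) ^ (θ - γ) := by positivity
    rw [hY]; linarith
  have hY0 : 0 ≤ Y := hX0.trans hXY
  refine le_trans ?_ (mul_le_mul_of_nonneg_right (show Cμ ≤ Cpi + Cμ by linarith) hY0)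
  rw [hCμ, div_mul_eq_mul_div (2 / cμ + d2 * Cpi + m + 3)]
  refine div_le_div_of_nonneg_right ?_ hd'.le
  have hm0 : 0 ≤ m := by positivity
  have hc0 : 0 ≤ 2 / cμ := by positivity
  have h1 := mul_le_mul_of_nonneg_left (show x ≤ Y by linarith) hc0
  have h2 := mul_le_mul_of_nonneg_left hXY (mul_nonneg hd2 hCpi0.le)
  have h3 := mul_le_mul_of_nonneg_left (show εP ≤ Y by linarith) hm0
  have h4 := mul_le_of_le_one_left hε.le (show 1 - d ≤ 1 by linarith)
  linarith
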